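/- Let c be a positive integer. Then ∑_{d mod c, gcd(d,c)=1} ∑_{r ∈ (ℤ^m)/(cℤ^m)} e( d·(Q(r̃ − γ) + n)/c ) = ∑_{a | c} μ(c/a) · a · (c/a)^m · N_{γ,n}(a), where e(x) = e^{2πix}, r̃ ∈ ℤ^m is a representative of r (the summand is independent of this choice), μ is the Möbius function, and the sum on the right runs over positive divisors a of c. -/

import Mathlib

open Finset Matrix

namespace EisensteinWeil

variable {m : ℕ}

/-- The bilinear form `(x,y) = xᵀ S y` on `ℚ^m`. -/
def bil (S : Matrix (Fin m) (Fin m) ℤ) (x y : Fin m → ℚ) : ℚ :=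
  x ⬝ᵥ (S.map (Int.cast : ℤ → ℚ)).mulVec y

/-- The quadratic form `Q(x) = (x,x)/2`. -/
def Qf (S : Matrix (Fin m) (Fin m) ℤ) (x : Fin m → ℚ) : ℚ := bil S x x / 2

/-- Membership in the dual lattice `L' = S⁻¹ℤ^m`: `x ∈ L'` iff `(x,r) ∈ ℤ` for all `r ∈ ℤ^m`. -/
def memDual (S : Matrix (Fin m) (Fin m) ℤ) (γ : Fin m → ℚ) : Prop :=
  ∀ r : Fin m → ℤ, ∃ z : ℤ, bil S γ (fun i => (r i : ℚ)) = z

/-- `N` is the order of `γ + ℤ^m` in `L'/ℤ^m`, i.e. the smallest positive integer with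
`N • γ ∈ ℤ^m`. -/
def isOrderOf (γ : Fin m → ℚ) (N : ℕ) : Prop :=
  0 < N ∧ (∀ i, ∃ z : ℤ, (N : ℚ) * γ i = z) ∧
    ∀ k : ℕ, 0 < k → (∀ i, ∃ z : ℤ, (k : ℚ) * γ i = z) → N ≤ k

/-- The representation number `N_{γ,n}(a)`, counting `r ∈ (ℤ^m)/(aℤ^m)`
(represented by `r : Fin m → Fin a`) with `Q(r − γ) + n ≡ 0 (mod a)`. -/
noncomputable def repNum (S : Matrix (Fin m) (Fin m) ℤ) (γ : Fin m → ℚ) (n : ℚ) (a : ℕ) : ℕ :=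
  Nat.card {r : Fin m → Fin a //
    ∃ t : ℤ, Qf S ((fun i => ((r i : ℕ) : ℚ)) - γ) + n = (a : ℚ) * t}

/-- `e(x) = e^{2πix}`. -/
noncomputable def eQ (x : ℚ) : ℂ := Complex.exp (2 * Real.pi * Complex.I * (x : ℂ))

/-- A canonical choice of inverse of `d` modulo `c`. -/
def adInv (c d : ℕ) : ℕ := ((d : ZMod c)⁻¹).val

/-- The sum `G_{γ,n}(c; β, χ)`. -/
noncomputable def Gsum (S : Matrix (Fin m) (Fin m) ℤ) (γ : Fin m → ℚ) (n : ℚ)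
    (β : Fin m → ℚ) (Nβ : ℕ) (χ : DirichletCharacter ℂ Nβ) (c : ℕ) : ℂ :=
  ∑ ν ∈ (range Nβ).filter (fun ν => Nat.Coprime ν Nβ), χ (ν : ZMod Nβ) *
    ∑ d ∈ (range c).filter (fun d => Nat.Coprime d c),
      ∑ r ∈ Fintype.piFinset (fun _ : Fin m => range c),
        eQ (((adInv c d : ℚ) * Qf S (ν • β + fun i => (r i : ℚ))
            - bil S γ (ν • β + fun i => (r i : ℚ))
            + (d : ℚ) * (Qf S γ + n)) / c)

/-- The Gauss sum `G(χ) = ∑_{u mod N, gcd(u,N)=1} χ(u) e(u/N)`. -/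
noncomputable def gaussS (N : ℕ) (χ : DirichletCharacter ℂ N) : ℂ :=
  ∑ u ∈ (range N).filter (fun u => Nat.Coprime u N), χ (u : ZMod N) * eQ (u / N)


theorem bil_comm {S : Matrix (Fin m) (Fin m) ℤ} (hS : S.IsSymm) (x y : Fin m → ℚ) :
    bil S x y = bil S y x := by
  have h : (S.map (Int.cast : ℤ → ℚ))ᵀ = S.map (Int.cast : ℤ → ℚ) := by
    rw [← transpose_map, hS.eq]
  unfold bil
  rw [dotProduct_mulVec, ← mulVec_transpose, h, dotProduct_comm]

theorem bil_add_left (S : Matrix (Fin m) (Fin m) ℤ) (x y z : Fin m → ℚ) :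
    bil S (x + y) z = bil S x z + bil S y z := by
  simp [bil, add_dotProduct]

theorem bil_add_right (S : Matrix (Fin m) (Fin m) ℤ) (x y z : Fin m → ℚ) :
    bil S x (y + z) = bil S x y + bil S x z := by
  simp [bil, mulVec_add, dotProduct_add]

theorem bil_smul_right (S : Matrix (Fin m) (Fin m) ℤ) (k : ℚ) (x y : Fin m → ℚ) :
    bil S x (k • y) = k * bil S x y := by
  simp [bil, mulVec_smul, dotProduct_smul]

theorem bil_smul_left (S : Matrix (Fin m) (Fin m) ℤ) (k : ℚ) (x y : Fin m → ℚ) :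
    bil S (k • x) y = k * bil S x y := by
  simp [bil, smul_dotProduct]

theorem Qf_add {S : Matrix (Fin m) (Fin m) ℤ} (hS : S.IsSymm) (x y : Fin m → ℚ) :
    Qf S (x + y) = Qf S x + bil S x y + Qf S y := by
  unfold Qf
  rw [bil_add_left, bil_add_right, bil_add_right, bil_comm hS y x]
  ring

theorem Qf_smul (S : Matrix (Fin m) (Fin m) ℤ) (k : ℚ) (x : Fin m → ℚ) :
    Qf S (k • x) = k ^ 2 * Qf S x := by
  unfold Qf
  rw [bil_smul_left, bil_smul_right]
  ring

theorem bil_intCast (S : Matrix (Fin m) (Fin m) ℤ) (x y : Fin m → ℤ) :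
    bil S (fun i => (x i : ℚ)) (fun i => (y i : ℚ)) = ((x ⬝ᵥ S.mulVec y : ℤ) : ℚ) := by
  simp [bil, dotProduct, mulVec]

/-- An even symmetric matrix is `U + Uᵀ` with `U` integral. -/
theorem exists_eq_add_transpose {S : Matrix (Fin m) (Fin m) ℤ} (hS : S.IsSymm)
    (hSeven : ∀ i, 2 ∣ S i i) : ∃ U : Matrix (Fin m) (Fin m) ℤ, S = U + Uᵀ := by
  refine ⟨fun i j => if i < j then S i j else if i = j then S i i / 2 else 0, ?_⟩
  ext i j
  change S i j = (if i < j then S i j else if i = j then S i i / 2 else 0) +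
    (if j < i then S j i else if j = i then S j j / 2 else 0)
  rcases lt_trichotomy i j with h | rfl | h
  · simp [h, h.not_gt, h.ne']
  · have := hSeven i
    simp only [lt_irrefl, if_true, if_false]
    omega
  · simp [h, h.not_gt, h.ne', hS.apply i j]

theorem exists_Qf_intCast {S : Matrix (Fin m) (Fin m) ℤ} (hS : S.IsSymm)
    (hSeven : ∀ i, 2 ∣ S i i) (x : Fin m → ℤ) :
    ∃ z : ℤ, Qf S (fun i => (x i : ℚ)) = z := by
  obtain ⟨U, rfl⟩ := exists_eq_add_transpose hS hSeven
  refine ⟨x ⬝ᵥ U.mulVec x, ?_⟩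
  rw [Qf, bil_intCast, add_mulVec, dotProduct_add, dotProduct_transpose_mulVec]
  push_cast
  ring

/-- The shifted quadratic form is integral on `ℤ^m`, and its residue modulo `a` only depends on
the argument modulo `a`. -/
theorem exists_int_valued_shift {S : Matrix (Fin m) (Fin m) ℤ} (hS : S.IsSymm)
    (hSeven : ∀ i, 2 ∣ S i i) {γ : Fin m → ℚ} (hγ : memDual S γ) {n : ℚ}
    (hn : ∃ z : ℤ, n + Qf S γ = z) :
    ∃ A : (Fin m → ℕ) → ℤ, (∀ r, Qf S ((fun i => (r i : ℚ)) - γ) + n = A r) ∧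
      ∀ (a : ℕ) (r s : Fin m → ℕ), (a : ℤ) ∣ A (r + a • s) ↔ (a : ℤ) ∣ A r := by
  obtain ⟨w, hw⟩ := hn
  choose q hq using exists_Qf_intCast hS hSeven
  choose b hb using hγ
  let ι : (Fin m → ℕ) → Fin m → ℤ := fun r i => (r i : ℤ)
  have hA : ∀ r : Fin m → ℕ,
      Qf S ((fun i => (r i : ℚ)) - γ) + n = ((q (ι r) - b (ι r) + w : ℤ) : ℚ) := by
    intro r
    have e : (fun i => (r i : ℚ)) - γ = (-1 : ℚ) • γ + fun i => ((ι r i : ℤ) : ℚ) := by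
      ext i
      simp [ι, sub_eq_neg_add]
    rw [e, Qf_add hS, Qf_smul, bil_smul_left, hq, hb]
    push_cast
    rw [← hw]
    ring
  refine ⟨fun r => q (ι r) - b (ι r) + w, hA, fun a r s => ?_⟩
  have key : q (ι (r + a • s)) - b (ι (r + a • s)) + w = q (ι r) - b (ι r) + w +
      a * (ι r ⬝ᵥ S.mulVec (ι s) - b (ι s) + a * q (ι s)) := by
    have h : (fun i => ((ι (r + a • s) i : ℤ) : ℚ)) =
        (fun i => ((ι r i : ℤ) : ℚ)) + (a : ℚ) • fun i => ((ι s i : ℤ) : ℚ) := by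
      ext i
      simp [ι]
    have h₁ := hq (ι (r + a • s))
    rw [h, Qf_add hS, Qf_smul, bil_smul_right, hq, hq, bil_intCast] at h₁
    have h₂ := hb (ι (r + a • s))
    rw [h, bil_add_right, bil_smul_right, hb, hb] at h₂
    have h₃ : ((q (ι (r + a • s)) - b (ι (r + a • s)) + w : ℤ) : ℚ) =
        ((q (ι r) - b (ι r) + w +
          a * (ι r ⬝ᵥ S.mulVec (ι s) - b (ι s) + a * q (ι s)) : ℤ) : ℚ) := by
      push_cast [← h₁, ← h₂]
      ring
    exact_mod_cast h₃
  change (a : ℤ) ∣ q (ι (r + a • s)) - b (ι (r + a • s)) + w ↔ _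
  rw [key]
  exact dvd_add_left (dvd_mul_right _ _)

theorem eQ_natCast_mul (k : ℕ) (x : ℚ) : eQ (k * x) = eQ x ^ k := by
  unfold eQ
  rw [← Complex.exp_nat_mul]
  push_cast
  ring_nf

theorem eQ_eq_one_iff (x : ℚ) : eQ x = 1 ↔ ∃ z : ℤ, x = z := by
  unfold eQ
  rw [Complex.exp_eq_one_iff]
  refine exists_congr fun z => ?_
  rw [mul_comm, mul_left_inj' Complex.two_pi_I_ne_zero]
  norm_cast

theorem sum_range_eQ {c : ℕ} (hc : 0 < c) (A : ℤ) :
    ∑ k ∈ range c, eQ (k * (A / c)) = if (c : ℤ) ∣ A then (c : ℂ) else 0 := by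
  have hc' : (c : ℚ) ≠ 0 := by positivity
  have h1 : eQ (A / c) = 1 ↔ (c : ℤ) ∣ A := by
    rw [eQ_eq_one_iff]
    refine exists_congr fun z => ?_
    rw [div_eq_iff hc', mul_comm]
    norm_cast
  simp_rw [eQ_natCast_mul]
  split_ifs with h
  · simp [h1.2 h]
  · have hpow : eQ (A / c) ^ c = 1 := by
      rw [← eQ_natCast_mul, eQ_eq_one_iff]
      exact ⟨A, by field_simp⟩
    rw [geom_sum_eq (mt h1.1 h), hpow, sub_self, zero_div]

theorem sum_divisors_moebius_dvd {c : ℕ} (hc : 0 < c) (d : ℕ) :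
    ∑ g ∈ c.divisors, (if g ∣ d then (ArithmeticFunction.moebius g : ℂ) else 0) =
      if d.Coprime c then 1 else 0 := by
  have h : c.divisors.filter (· ∣ d) = (d.gcd c).divisors := by
    ext g
    simp only [mem_filter, Nat.mem_divisors, Nat.dvd_gcd_iff]
    constructor
    · rintro ⟨⟨h1, h2⟩, h3⟩
      exact ⟨⟨h3, h1⟩, Nat.gcd_ne_zero_right h2⟩
    · rintro ⟨⟨h3, h1⟩, -⟩
      exact ⟨⟨h1, hc.ne'⟩, h3⟩
  rw [← sum_filter, h, ← Int.cast_sum, ← ArithmeticFunction.coe_mul_zeta_apply,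
    ArithmeticFunction.moebius_mul_coe_zeta, ArithmeticFunction.one_apply]
  simp [Nat.Coprime]

theorem sum_range_mul_filter_dvd {g : ℕ} (hg : 0 < g) (b : ℕ) (F : ℕ → ℂ) :
    ∑ d ∈ range (g * b) with g ∣ d, F d = ∑ k ∈ range b, F (g * k) := by
  symm
  refine sum_nbij' (fun k => g * k) (fun d => d / g) ?_ ?_ ?_ ?_ ?_
  · intro k hk
    simpa [hg] using hk
  · intro d hd
    simp only [mem_filter, mem_range] at hd ⊢
    exact Nat.div_lt_of_lt_mul hd.1
  · intro k _
    simp [hg]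
  · intro d hd
    exact Nat.mul_div_cancel' (mem_filter.1 hd).2
  · intro k _
    rfl

/-- Evaluation of Ramanujan's sum. -/
theorem sum_coprime_eQ {c : ℕ} (hc : 0 < c) (A : ℤ) :
    ∑ d ∈ (range c).filter (fun d => Nat.Coprime d c), eQ (d * A / c) =
      ∑ a ∈ c.divisors, (ArithmeticFunction.moebius (c / a) : ℂ) * a *
        if (a : ℤ) ∣ A then 1 else 0 := by
  calc _ = ∑ d ∈ range c, ∑ g ∈ c.divisors,
        if g ∣ d then (ArithmeticFunction.moebius g : ℂ) * eQ (d * A / c) else 0 := by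
        rw [sum_filter]
        refine sum_congr rfl fun d _ => ?_
        rw [← one_mul (eQ _), ← ite_zero_mul, ← sum_divisors_moebius_dvd hc, sum_mul]
        simp only [ite_zero_mul, one_mul]
    _ = ∑ g ∈ c.divisors, (ArithmeticFunction.moebius g : ℂ) *
        if ((c / g : ℕ) : ℤ) ∣ A then ((c / g : ℕ) : ℂ) else 0 := by
        rw [sum_comm]
        refine sum_congr rfl fun g hg => ?_
        obtain ⟨b, rfl⟩ := Nat.dvd_of_mem_divisors hg
        have hg0 : 0 < g := Nat.pos_of_mul_pos_right hc
        have hb0 : 0 < b := Nat.pos_of_mul_pos_left hc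
        rw [← sum_filter, sum_range_mul_filter_dvd hg0, ← mul_sum, Nat.mul_div_cancel_left b hg0,
          ← sum_range_eQ hb0]
        congr 1
        refine sum_congr rfl fun k _ => congrArg eQ ?_
        have : (g : ℚ) ≠ 0 := by positivity
        have : (b : ℚ) ≠ 0 := by positivity
        push_cast
        field_simp
    _ = _ := by
        rw [← Nat.sum_div_divisors]
        refine sum_congr rfl fun g hg => ?_
        rw [Nat.div_div_self (Nat.dvd_of_mem_divisors hg) hc.ne', mul_assoc, mul_boole]

/-- A predicate that is periodic modulo `a` holds on `b ^ m` times as many points of the box of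
side `a * b` as of the box of side `a`. -/
theorem card_filter_piFinset_range_mul {a b : ℕ} (ha : 0 < a) (P : (Fin m → ℕ) → Prop)
    [DecidablePred P] (hP : ∀ r s, P (r + a • s) ↔ P r) :
    #{r ∈ Fintype.piFinset (fun _ : Fin m => range (a * b)) | P r} =
      b ^ m * #{r ∈ Fintype.piFinset (fun _ : Fin m => range a) | P r} := by
  have hb : b ^ m = #(Fintype.piFinset (fun _ : Fin m => range b)) := by simp
  have hr : ∀ r : Fin m → ℕ, (fun i => r i % a) + a • (fun i => r i / a) = r := by
    intro r
    ext i
    simp [Nat.mod_add_div]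
  rw [hb, ← card_product]
  refine card_nbij' (fun r => (fun i => r i / a, fun i => r i % a)) (fun p => p.2 + a • p.1)
    ?_ ?_ ?_ ?_
  · intro r h
    simp only [coe_filter, Set.mem_ofPred_eq, Fintype.mem_piFinset, mem_range, coe_product,
      Set.mem_prod, mem_coe] at h ⊢
    refine ⟨fun i => Nat.div_lt_of_lt_mul (h.1 i), fun i => Nat.mod_lt _ ha, ?_⟩
    rw [← hP _ (fun i => r i / a), hr]
    exact h.2
  · rintro ⟨s, r⟩ h
    simp only [coe_filter, Set.mem_ofPred_eq, Fintype.mem_piFinset, mem_range, coe_product,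
      Set.mem_prod, mem_coe] at h ⊢
    refine ⟨fun i => ?_, (hP _ _).2 h.2.2⟩
    have h1 := h.1 i
    have h2 := h.2.1 i
    simp only [Pi.add_apply, Pi.smul_apply, smul_eq_mul]
    calc r i + a * s i < a + a * s i := by omega
      _ = a * (s i + 1) := by ring
      _ ≤ a * b := Nat.mul_le_mul_left a h1
  · intro r _
    exact hr r
  · rintro ⟨s, r⟩ h
    simp only [coe_filter, Set.mem_ofPred_eq, Fintype.mem_piFinset, mem_range, coe_product,
      Set.mem_prod, mem_coe] at h
    ext i
    · simp [Nat.add_mul_div_left _ _ ha, Nat.div_eq_of_lt (h.2.1 i)]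
    · simp [Nat.mod_eq_of_lt (h.2.1 i)]

theorem card_subtype_fin_eq_card_filter (a : ℕ) (P : (Fin m → ℕ) → Prop) [DecidablePred P] :
    Nat.card {r : Fin m → Fin a // P (fun i => r i)} =
      #{r ∈ Fintype.piFinset (fun _ : Fin m => range a) | P r} := by
  rw [Nat.card_eq_fintype_card, Fintype.card_subtype]
  refine card_bij (fun r _ i => (r i : ℕ)) ?_ ?_ ?_
  · intro r h
    simpa using h
  · intro r _ s _ h
    ext i
    exact congrFun h i
  · intro r h
    simp only [mem_filter, Fintype.mem_piFinset, mem_range] at h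
    exact ⟨fun i => ⟨r i, h.1 i⟩, by simpa using h.2, rfl⟩

/-- evaluation of the Ramanujan-type double sum in terms of representation
numbers. -/
theorem ramanujan_sum_eval (m : ℕ) (hm : 1 ≤ m) (S : Matrix (Fin m) (Fin m) ℤ)
    (hSsymm : S.IsSymm) (hSeven : ∀ i, 2 ∣ S i i) (hSdet : S.det ≠ 0)
    (γ : Fin m → ℚ) (hγ : memDual S γ) (n : ℚ) (hn : ∃ z : ℤ, n + Qf S γ = z)
    (c : ℕ) (hc : 0 < c) :
    ∑ d ∈ (range c).filter (fun d => Nat.Coprime d c),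
      ∑ r ∈ Fintype.piFinset (fun _ : Fin m => range c),
        eQ ((d * (Qf S ((fun i => (r i : ℚ)) - γ) + n)) / c) =
      ∑ a ∈ c.divisors, (ArithmeticFunction.moebius (c / a) : ℂ) * (a : ℂ) *
        ((c / a : ℕ) : ℂ) ^ m * (repNum S γ n a : ℂ) := by
  obtain ⟨A, hA, hper⟩ := exists_int_valued_shift hSsymm hSeven hγ hn
  have hrep : ∀ a : ℕ, repNum S γ n a =
      #{r ∈ Fintype.piFinset (fun _ : Fin m => range a) | (a : ℤ) ∣ A r} := by
    intro a
    rw [← card_subtype_fin_eq_card_filter a (fun r => (a : ℤ) ∣ A r)]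
    refine Nat.card_congr (Equiv.subtypeEquivRight fun r => exists_congr fun t => ?_)
    rw [hA (fun i => r i)]
    norm_cast
  simp_rw [hA]
  rw [sum_comm]
  simp_rw [sum_coprime_eQ hc]
  rw [sum_comm]
  refine sum_congr rfl fun a ha => ?_
  obtain ⟨b, rfl⟩ := Nat.dvd_of_mem_divisors ha
  have ha0 : 0 < a := Nat.pos_of_mul_pos_right hc
  rw [← mul_sum, sum_boole, card_filter_piFinset_range_mul ha0 _ (hper a), ← hrep,
    Nat.mul_div_cancel_left b ha0]
  push_cast
  ring

end EisensteinWeil
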